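/- Let (X,ρ_X) and (Y,ρ_Y) be semimetric spaces of negative type, and let (X,Y) be a pair of random variables with joint distribution P_XY and marginals P_X, P_Y having finite second moments w.r.t. ρ_X and ρ_Y respectively. Let k_X and k_Y be any kernels generating ρ_X and ρ_Y respectively, and let k((x,y),(x',y')) = k_X(x,x')k_Y(y,y') be the product kernel on X×Y. Then the generalized distance covariance satisfies V²_{ρ_X,ρ_Y}(X,Y) = 4γ_k²(P_XY, P_X P_Y); explicitly, E_{XY}E_{X'Y'}ρ_X(X,X')ρ_Y(Y,Y') + E_X E_{X'}ρ_X(X,X')·E_Y E_{Y'}ρ_Y(Y,Y') − 2E_{XY}[E_{X'}ρ_X(X,X')·E_{Y'}ρ_Y(Y,Y')] = 4∫∫ k d([P_XY−P_X P_Y]×[P_XY−P_X P_Y]). -/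

import Mathlib

open MeasureTheory

/-- A semimetric on a nonempty set `Z`: nonnegative, vanishing exactly on the
diagonal, and symmetric. -/
def IsSemimetric {Z : Type*} (ρ : Z → Z → ℝ) : Prop :=
  (∀ z z', 0 ≤ ρ z z') ∧ (∀ z z', ρ z z' = 0 ↔ z = z') ∧ (∀ z z', ρ z z' = ρ z' z)

/-- A function `ρ` has negative type if for all `n ≥ 2`, points `z_1,…,z_n` and
reals `α_1,…,α_n` with `Σ α_i = 0`, one has `Σ_i Σ_j α_i α_j ρ(z_i,z_j) ≤ 0`. -/
def HasNegativeType {Z : Type*} (ρ : Z → Z → ℝ) : Prop :=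
  ∀ (n : ℕ), 2 ≤ n → ∀ (z : Fin n → Z) (α : Fin n → ℝ),
    (∑ i, α i) = 0 → ∑ i, ∑ j, α i * α j * ρ (z i) (z j) ≤ 0

/-- A kernel on `Z`: a symmetric positive definite function `k : Z × Z → ℝ`. -/
def IsPosDefKernel {Z : Type*} (k : Z → Z → ℝ) : Prop :=
  (∀ z z', k z z' = k z' z) ∧
  ∀ (n : ℕ) (z : Fin n → Z) (α : Fin n → ℝ),
    0 ≤ ∑ i, ∑ j, α i * α j * k (z i) (z j)

namespace IsPosDefKernel

variable {Z : Type*} {k : Z → Z → ℝ}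

theorem quadratic_nonneg (hk : IsPosDefKernel k) (z z' : Z) (s t : ℝ) :
    0 ≤ s ^ 2 * k z z + 2 * (s * t) * k z z' + t ^ 2 * k z' z' := by
  have h := hk.2 2 ![z, z'] ![s, t]
  simp only [Fin.sum_univ_two, Matrix.cons_val_zero, Matrix.cons_val_one, hk.1 z' z] at h
  linarith

theorem diag_nonneg (hk : IsPosDefKernel k) (z : Z) : 0 ≤ k z z := by
  simpa using hk.quadratic_nonneg z z 1 0

theorem abs_le_add (hk : IsPosDefKernel k) (z z' : Z) : |k z z'| ≤ k z z + k z' z' := by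
  have h₁ := hk.quadratic_nonneg z z' 1 1
  have h₂ := hk.quadratic_nonneg z z' 1 (-1)
  have h₃ := hk.diag_nonneg z
  have h₄ := hk.diag_nonneg z'
  exact abs_le.2 ⟨by linarith, by linarith⟩

/-- If the semimetric generated by `k` has a finite second moment, then the diagonal of `k`
is square integrable. -/
theorem memLp_diag [MeasurableSpace Z] (hk : IsPosDefKernel k)
    (hm : Measurable fun p : Z × Z => k p.1 p.2) {μ : Measure Z} [IsFiniteMeasure μ]
    {ρ : Z → Z → ℝ} (hρ : ∀ z z', ρ z z' = k z z + k z' z' - 2 * k z z') {z₀ : Z}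
    (hmom : Integrable (fun z => ρ z z₀ ^ 2) μ) : MemLp (fun z => k z z) 2 μ := by
  have hd : Measurable fun z => k z z := hm.comp (measurable_id.prodMk measurable_id)
  have hk₀ : Measurable fun z => k z z₀ := hm.comp (measurable_id.prodMk measurable_const)
  have hρm : Measurable fun z => ρ z z₀ := by
    simp only [hρ]
    fun_prop
  have hρL : MemLp (fun z => ρ z z₀) 2 μ :=
    (memLp_two_iff_integrable_sq hρm.aestronglyMeasurable).2 hmom
  refine ((hρL.const_mul 2).add (memLp_const (2 * k z₀ z₀))).mono' hd.aestronglyMeasurable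
    (.of_forall fun z => ?_)
  have h := hk.quadratic_nonneg z z₀ 1 (-2)
  simp only [Real.norm_eq_abs, abs_of_nonneg (hk.diag_nonneg z), Pi.add_apply, hρ]
  linarith

end IsPosDefKernel

/-- A function of two variables dominated by a sum of square integrable functions of one
variable is square integrable for the product measure. -/
theorem memLp_two_prod_of_abs_le_add {α β : Type*} [MeasurableSpace α] [MeasurableSpace β]
    {μ : Measure α} {ν : Measure β} [IsFiniteMeasure μ] [IsFiniteMeasure ν] {a : α → β → ℝ}
    {u : α → ℝ} {v : β → ℝ} (ha : Measurable fun p : α × β => a p.1 p.2)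
    (hu : MemLp u 2 μ) (hv : MemLp v 2 ν) (h : ∀ x y, |a x y| ≤ u x + v y) :
    MemLp (fun p : α × β => a p.1 p.2) 2 (μ.prod ν) :=
  ((hu.comp_fst ν).add (hv.comp_snd μ)).mono' ha.aestronglyMeasurable
    (.of_forall fun p => h p.1 p.2)

/-- The distance covariance functional of two functions of two variables on one space. -/
noncomputable def distCov {Ω : Type*} [MeasurableSpace Ω] (μ : Measure Ω) (a b : Ω → Ω → ℝ) : ℝ :=
  (∫ p, ∫ p', a p p' * b p p' ∂μ ∂μ) + (∫ p, ∫ p', a p p' ∂μ ∂μ) * (∫ p, ∫ p', b p p' ∂μ ∂μ)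
    - 2 * ∫ p, (∫ p', a p p' ∂μ) * (∫ p', b p p' ∂μ) ∂μ

/-- Measurable functions of two variables dominated by `w p + w p'` with `w` square integrable. -/
def SqDominated {Ω : Type*} [MeasurableSpace Ω] (μ : Measure Ω) (a : Ω → Ω → ℝ) : Prop :=
  (Measurable fun q : Ω × Ω => a q.1 q.2) ∧ ∃ w, MemLp w 2 μ ∧ ∀ p p', |a p p'| ≤ w p + w p'

namespace SqDominated

variable {Ω : Type*} [MeasurableSpace Ω] {μ : Measure Ω} [IsProbabilityMeasure μ]
  {a : Ω → Ω → ℝ}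

theorem memLp_prod (ha : SqDominated μ a) :
    MemLp (fun q : Ω × Ω => a q.1 q.2) 2 (μ.prod μ) := by
  obtain ⟨hm, w, hw, h⟩ := ha
  exact memLp_two_prod_of_abs_le_add hm hw hw h

theorem integrable_apply (ha : SqDominated μ a) (p : Ω) : Integrable (a p) μ := by
  obtain ⟨hm, w, hw, h⟩ := ha
  exact ((integrable_const (w p)).add (hw.integrable one_le_two)).mono'
    (hm.comp measurable_prodMk_left).aestronglyMeasurable (.of_forall (h p))

theorem memLp_integral (ha : SqDominated μ a) : MemLp (fun p => ∫ p', a p p' ∂μ) 2 μ := by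
  have hm := ha.1.stronglyMeasurable.integral_prod_right (ν := μ)
  have hint := ha.integrable_apply
  obtain ⟨-, w, hw, h⟩ := ha
  have hw1 := hw.integrable one_le_two
  refine (hw.add (memLp_const (∫ p, w p ∂μ))).mono' hm.aestronglyMeasurable
    (.of_forall fun p => ?_)
  calc ‖∫ p', a p p' ∂μ‖ ≤ ∫ p', |a p p'| ∂μ := norm_integral_le_integral_norm _
    _ ≤ ∫ p', (w p + w p') ∂μ :=
      integral_mono (hint p).abs ((integrable_const _).add hw1) (h p)
    _ = w p + ∫ p', w p' ∂μ := by
      rw [integral_add (integrable_const _) hw1]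
      simp

end SqDominated

section distCov

variable {Ω : Type*} [MeasurableSpace Ω] {μ : Measure Ω} {b k : Ω → Ω → ℝ} {u : Ω → ℝ}

theorem integral_add_sub_two_mul {f g h : Ω → ℝ} (hf : Integrable f μ) (hg : Integrable g μ)
    (hh : Integrable h μ) : ∫ p, (f p + g p - 2 * h p) ∂μ =
      (∫ p, f p ∂μ) + (∫ p, g p ∂μ) - 2 * ∫ p, h p ∂μ := by
  rw [integral_sub (f := fun p => f p + g p) (hf.add hg) (hh.const_mul 2), integral_add hf hg,
    integral_const_mul]

theorem distCov_comm (a b : Ω → Ω → ℝ) : distCov μ a b = distCov μ b a := by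
  simp only [distCov, mul_comm]

theorem SqDominated.add_sub_two_mul (hum : Measurable u) (hu : MemLp u 2 μ)
    (hk : SqDominated μ k) : SqDominated μ (fun p p' => u p + u p' - 2 * k p p') := by
  obtain ⟨hm, w, hw, h⟩ := hk
  refine ⟨by fun_prop, fun p => |u p| + 2 * w p, hu.abs.add (hw.const_mul 2), fun p p' => ?_⟩
  have h₁ := abs_le.1 (h p p')
  have h₂ := abs_le.1 (le_refl |u p|)
  have h₃ := abs_le.1 (le_refl |u p'|)
  exact abs_le.2 ⟨by linarith, by linarith⟩

variable [IsProbabilityMeasure μ]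

/-- Terms depending on one variable only do not contribute to the distance covariance. -/
theorem distCov_add_sub_two_mul (hu : MemLp u 2 μ) (hk : SqDominated μ k) (hb : SqDominated μ b)
    (hsymm : ∀ p p', b p p' = b p' p) :
    distCov μ (fun p p' => u p + u p' - 2 * k p p') b = -2 * distCov μ k b := by
  have hbL := hb.memLp_prod
  have hB := hb.memLp_integral
  have hK := hk.memLp_integral
  have hu1 := hu.integrable one_le_two
  have h1 : Integrable (fun q : Ω × Ω => u q.1 * b q.1 q.2) (μ.prod μ) :=
    (hu.comp_fst μ).integrable_mul hbL
  have h2 : Integrable (fun q : Ω × Ω => u q.2 * b q.1 q.2) (μ.prod μ) :=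
    (hu.comp_snd μ).integrable_mul hbL
  have h3 : Integrable (fun q : Ω × Ω => k q.1 q.2 * b q.1 q.2) (μ.prod μ) :=
    hk.memLp_prod.integrable_mul hbL
  have huB : Integrable (fun p => u p * ∫ p', b p p' ∂μ) μ := hu.integrable_mul hB
  have hKB : Integrable (fun p => (∫ p', k p p' ∂μ) * ∫ p', b p p' ∂μ) μ := hK.integrable_mul hB
  have hB1 := hB.integrable one_le_two
  have hK1 := hK.integrable one_le_two
  have e1 : ∫ q, u q.1 * b q.1 q.2 ∂(μ.prod μ) = ∫ p, u p * ∫ p', b p p' ∂μ ∂μ := by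
    rw [integral_prod _ h1]
    simp only [integral_const_mul]
  have e2 : ∫ q, u q.2 * b q.1 q.2 ∂(μ.prod μ) = ∫ p, u p * ∫ p', b p p' ∂μ ∂μ := by
    rw [integral_prod_symm _ h2]
    simp only [integral_const_mul, hsymm]
  have e3 : ∫ q, k q.1 q.2 * b q.1 q.2 ∂(μ.prod μ) = ∫ p, ∫ p', k p p' * b p p' ∂μ ∂μ :=
    integral_prod _ h3
  have first : ∫ p, ∫ p', (u p + u p' - 2 * k p p') * b p p' ∂μ ∂μ =
      2 * (∫ p, u p * ∫ p', b p p' ∂μ ∂μ) - 2 * ∫ p, ∫ p', k p p' * b p p' ∂μ ∂μ := by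
    have h : (fun q : Ω × Ω => (u q.1 + u q.2 - 2 * k q.1 q.2) * b q.1 q.2) =
        fun q => u q.1 * b q.1 q.2 + u q.2 * b q.1 q.2 - 2 * (k q.1 q.2 * b q.1 q.2) := by
      ext q
      ring
    rw [← integral_prod (fun q : Ω × Ω => (u q.1 + u q.2 - 2 * k q.1 q.2) * b q.1 q.2)
      (by rw [h]; exact (h1.add h2).sub (h3.const_mul 2)), h,
      integral_add_sub_two_mul h1 h2 h3, e1, e2, e3]
    ring
  have inner (p : Ω) : ∫ p', (u p + u p' - 2 * k p p') ∂μ =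
      u p + (∫ p', u p' ∂μ) - 2 * ∫ p', k p p' ∂μ := by
    have hc : Integrable (fun _ : Ω => u p) μ := integrable_const _
    rw [integral_add_sub_two_mul hc hu1 (hk.integrable_apply p)]
    simp
  have total : ∫ p, ∫ p', (u p + u p' - 2 * k p p') ∂μ ∂μ =
      2 * (∫ p, u p ∂μ) - 2 * ∫ p, ∫ p', k p p' ∂μ ∂μ := by
    have hc : Integrable (fun _ : Ω => ∫ p', u p' ∂μ) μ := integrable_const _
    simp only [inner]
    rw [integral_add_sub_two_mul hu1 hc hK1, integral_const, probReal_univ, one_smul]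
    ring
  have cross : ∫ p, (∫ p', (u p + u p' - 2 * k p p') ∂μ) * (∫ p', b p p' ∂μ) ∂μ =
      (∫ p, u p * ∫ p', b p p' ∂μ ∂μ) + (∫ p, u p ∂μ) * (∫ p, ∫ p', b p p' ∂μ ∂μ)
        - 2 * ∫ p, (∫ p', k p p' ∂μ) * (∫ p', b p p' ∂μ) ∂μ := by
    have hc := hB1.const_mul (∫ p', u p' ∂μ)
    simp only [inner, sub_mul, add_mul, mul_assoc]
    rw [integral_add_sub_two_mul huB hc hKB, integral_const_mul]
  simp only [distCov]
  rw [first, total, cross]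
  ring

end distCov

/-- for semimetric spaces `(X,ρ_X)`, `(Y,ρ_Y)` of negative type,
kernels `k_X`, `k_Y` generating them, and a joint Borel probability distribution
`P_XY` whose marginals have finite second moments w.r.t. `ρ_X`, `ρ_Y`, the
generalized distance covariance equals four times the squared MMD between the
joint distribution and the product of the marginals, computed with the product
kernel `k((x,y),(x',y')) = k_X(x,x') k_Y(y,y')`:
`V²_{ρ_X,ρ_Y}(X,Y) = 4 γ_k²(P_XY, P_X P_Y)`. -/
theorem distance_covariance_eq_four_hsic
    {X : Type*} {Y : Type*} [Nonempty X] [Nonempty Y]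
    [TopologicalSpace X] [MeasurableSpace X] [BorelSpace X]
    [TopologicalSpace Y] [MeasurableSpace Y] [BorelSpace Y]
    (ρX : X → X → ℝ) (hsX : IsSemimetric ρX) (hnX : HasNegativeType ρX)
    (ρY : Y → Y → ℝ) (hsY : IsSemimetric ρY) (hnY : HasNegativeType ρY)
    (kX : X → X → ℝ) (hkX : IsPosDefKernel kX)
    (hmX : Measurable fun p : X × X => kX p.1 p.2)
    (hgenX : ∀ x x', ρX x x' = kX x x + kX x' x' - 2 * kX x x')
    (kY : Y → Y → ℝ) (hkY : IsPosDefKernel kY)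
    (hmY : Measurable fun p : Y × Y => kY p.1 p.2)
    (hgenY : ∀ y y', ρY y y' = kY y y + kY y' y' - 2 * kY y y')
    (PXY : Measure (X × Y)) [IsProbabilityMeasure PXY]
    (PX : Measure X) (hPX : PX = PXY.map Prod.fst)
    (PY : Measure Y) (hPY : PY = PXY.map Prod.snd)
    (hmomX : ∃ x₀ : X, Integrable (fun x => (ρX x x₀) ^ 2) PX)
    (hmomY : ∃ y₀ : Y, Integrable (fun y => (ρY y y₀) ^ 2) PY) :
    (∫ p, (∫ p', ρX p.1 p'.1 * ρY p.2 p'.2 ∂PXY) ∂PXY)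
      + (∫ x, (∫ x', ρX x x' ∂PX) ∂PX) * (∫ y, (∫ y', ρY y y' ∂PY) ∂PY)
      - 2 * (∫ p, (∫ x', ρX p.1 x' ∂PX) * (∫ y', ρY p.2 y' ∂PY) ∂PXY) =
    4 * ((∫ p, (∫ p', kX p.1 p'.1 * kY p.2 p'.2 ∂PXY) ∂PXY)
      - (∫ p, (∫ p', kX p.1 p'.1 * kY p.2 p'.2 ∂(PX.prod PY)) ∂PXY)
      - (∫ p, (∫ p', kX p.1 p'.1 * kY p.2 p'.2 ∂PXY) ∂(PX.prod PY))
      + (∫ p, (∫ p', kX p.1 p'.1 * kY p.2 p'.2 ∂(PX.prod PY)) ∂(PX.prod PY))) := by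
  obtain ⟨x₀, hx₀⟩ := hmomX
  obtain ⟨y₀, hy₀⟩ := hmomY
  have : IsProbabilityMeasure PX :=
    hPX ▸ Measure.isProbabilityMeasure_map measurable_fst.aemeasurable
  have : IsProbabilityMeasure PY :=
    hPY ▸ Measure.isProbabilityMeasure_map measurable_snd.aemeasurable
  have hfst : MeasurePreserving Prod.fst PXY PX := ⟨measurable_fst, hPX.symm⟩
  have hsnd : MeasurePreserving Prod.snd PXY PY := ⟨measurable_snd, hPY.symm⟩
  have hfX := hkX.memLp_diag hmX hgenX hx₀
  have hfY := hkY.memLp_diag hmY hgenY hy₀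
  have hu := hfX.comp_measurePreserving hfst
  have hv := hfY.comp_measurePreserving hsnd
  have hum : Measurable ((fun x => kX x x) ∘ (Prod.fst : X × Y → X)) :=
    hmX.comp (measurable_fst.prodMk measurable_fst)
  have hvm : Measurable ((fun y => kY y y) ∘ (Prod.snd : X × Y → Y)) :=
    hmY.comp (measurable_snd.prodMk measurable_snd)
  have hX : SqDominated PXY (fun p p' => kX p.1 p'.1) :=
    ⟨hmX.comp ((measurable_fst.comp measurable_fst).prodMk (measurable_fst.comp measurable_snd)),
      _, hu, fun p p' => hkX.abs_le_add p.1 p'.1⟩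
  have hY : SqDominated PXY (fun p p' => kY p.2 p'.2) :=
    ⟨hmY.comp ((measurable_snd.comp measurable_fst).prodMk (measurable_snd.comp measurable_snd)),
      _, hv, fun p p' => hkY.abs_le_add p.2 p'.2⟩
  have key : distCov PXY (fun p p' => ρX p.1 p'.1) (fun p p' => ρY p.2 p'.2) =
      4 * distCov PXY (fun p p' => kX p.1 p'.1) (fun p p' => kY p.2 p'.2) := by
    simp only [hgenX, hgenY]
    have h₁ := distCov_add_sub_two_mul hu hX (hY.add_sub_two_mul hvm hv)
      (fun p p' => by rw [hkY.1 p.2 p'.2]; ring)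
    have h₂ := distCov_add_sub_two_mul hv hY hX (fun p p' => hkX.1 p.1 p'.1)
    rw [distCov_comm] at h₂
    simp only [Function.comp_apply] at h₁ h₂
    rw [h₁, h₂, distCov_comm]
    ring
  have mapX (F : X → ℝ) (hF : Measurable F) : ∫ x, F x ∂PX = ∫ p, F p.1 ∂PXY := by
    rw [hPX, integral_map measurable_fst.aemeasurable hF.aestronglyMeasurable]
  have mapY (F : Y → ℝ) (hF : Measurable F) : ∫ y, F y ∂PY = ∫ p, F p.2 ∂PXY := by
    rw [hPY, integral_map measurable_snd.aemeasurable hF.aestronglyMeasurable]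
  have hmρX : Measurable fun p : X × X => ρX p.1 p.2 := by
    have h₁ : Measurable fun x => kX x x := hmX.comp (measurable_id.prodMk measurable_id)
    simp only [hgenX]
    fun_prop
  have hmρY : Measurable fun p : Y × Y => ρY p.1 p.2 := by
    have h₁ : Measurable fun y => kY y y := hmY.comp (measurable_id.prodMk measurable_id)
    simp only [hgenY]
    fun_prop
  have innerX (a : X → X → ℝ) (ha : Measurable fun p : X × X => a p.1 p.2) (x : X) :
      ∫ x', a x x' ∂PX = ∫ p, a x p.1 ∂PXY := mapX _ (ha.comp measurable_prodMk_left)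
  have innerY (a : Y → Y → ℝ) (ha : Measurable fun p : Y × Y => a p.1 p.2) (y : Y) :
      ∫ y', a y y' ∂PY = ∫ p, a y p.2 ∂PXY := mapY _ (ha.comp measurable_prodMk_left)
  have outerX (a : X → X → ℝ) (ha : Measurable fun p : X × X => a p.1 p.2) :
      ∫ x, ∫ x', a x x' ∂PX ∂PX = ∫ p, ∫ p', a p.1 p'.1 ∂PXY ∂PXY := by
    rw [mapX _ ha.stronglyMeasurable.integral_prod_right.measurable]
    simp only [innerX a ha]
  have outerY (a : Y → Y → ℝ) (ha : Measurable fun p : Y × Y => a p.1 p.2) :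
      ∫ y, ∫ y', a y y' ∂PY ∂PY = ∫ p, ∫ p', a p.2 p'.2 ∂PXY ∂PXY := by
    rw [mapY _ ha.stronglyMeasurable.integral_prod_right.measurable]
    simp only [innerY a ha]
  have prodInner (p : X × Y) : ∫ p', kX p.1 p'.1 * kY p.2 p'.2 ∂(PX.prod PY) =
      (∫ x', kX p.1 x' ∂PX) * ∫ y', kY p.2 y' ∂PY := integral_prod_mul _ _
  have prodOuter : ∫ p, (∫ x', kX p.1 x' ∂PX) * (∫ y', kY p.2 y' ∂PY) ∂(PX.prod PY) =
      (∫ x, ∫ x', kX x x' ∂PX ∂PX) * ∫ y, ∫ y', kY y y' ∂PY ∂PY :=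
    integral_prod_mul (fun x => ∫ x', kX x x' ∂PX) (fun y => ∫ y', kY y y' ∂PY)
  have hint : Integrable (fun q : (X × Y) × (X × Y) => kX q.1.1 q.2.1 * kY q.1.2 q.2.2)
      ((PX.prod PY).prod PXY) := by
    refine MemLp.integrable_mul (p := 2) (q := 2)
      (memLp_two_prod_of_abs_le_add (a := fun p p' : X × Y => kX p.1 p'.1) hX.1
        (hfX.comp_fst PY) hu fun p p' => hkX.abs_le_add p.1 p'.1)
      (memLp_two_prod_of_abs_le_add (a := fun p p' : X × Y => kY p.2 p'.2) hY.1
        (hfY.comp_snd PX) hv fun p p' => hkY.abs_le_add p.2 p'.2)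
  have swap : ∫ p, ∫ p', kX p.1 p'.1 * kY p.2 p'.2 ∂PXY ∂(PX.prod PY) =
      ∫ p, ∫ p', kX p.1 p'.1 * kY p.2 p'.2 ∂(PX.prod PY) ∂PXY := by
    rw [integral_integral_swap hint]
    refine integral_congr_ae (.of_forall fun p => integral_congr_ae (.of_forall fun p' => ?_))
    simp only [hkX.1 p'.1, hkY.1 p'.2]
  rw [swap]
  simp only [prodInner]
  rw [prodOuter, outerX _ hmX, outerY _ hmY, outerX _ hmρX, outerY _ hmρY]
  simp only [innerX _ hmX, innerY _ hmY, innerX _ hmρX, innerY _ hmρY]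
  simp only [distCov] at key
  linarith
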